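/- arXiv:2508.16287 — 5 statements merged into one kernel-verified Lean document; each statement's English description precedes it below -/
import Mathlib

section
/- Let A₁…A_m (m ≥ 3) be the outline of a convex polygon: the points Aᵢ are pairwise distinct, each Aᵢ is an extreme point of the convex hull K of {A₁, …, A_m}, and the cyclic order A₁, …, A_m agrees with the order of these points along the boundary of K. Then for any point O: if O ∉ K then w(A₁…A_m, O) = 0, and if O lies in the interior of K then w(A₁…A_m, O) = 1 or w(A₁…A_m, O) = −1. -/
open Real

/-- The cyclically next vertex after position `i`. -/
def cnext (l : List ℂ) (i : Fin l.length) : ℂ :=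
  l.get ⟨(i.1 + 1) % l.length, Nat.mod_lt _ (Nat.lt_of_le_of_lt (Nat.zero_le _) i.isLt)⟩

/-- The total angle `∑ᵢ ∠AᵢOAᵢ₊₁` (equal to `2π · w(l, O)`). -/
noncomputable def windingSum (O : ℂ) (l : List ℂ) : ℝ :=
  ∑ i : Fin l.length, Complex.arg ((cnext l i - O) / (l.get i - O))

/-- The closed polygonal line `l` does not pass through the point `O`. -/
def NotThrough (O : ℂ) (l : List ℂ) : Prop :=
  ∀ i : Fin l.length, O ∉ segment ℝ (l.get i) (cnext l i)


lemma wco_ext_mem {K S : Set ℂ} (hc : Convex ℝ K) (hS : S ⊆ K) {x : ℂ}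
    (hx : x ∈ Set.extremePoints ℝ K) (hxS : x ∈ convexHull ℝ S) : x ∈ S := by
  have h1 : convexHull ℝ S ⊆ K := convexHull_min hS hc
  exact extremePoints_convexHull_subset
    (inter_extremePoints_subset_extremePoints_of_subset h1 ⟨hxS, hx⟩)

/-- cross product -/
def wcoCross (u v : ℂ) : ℝ := u.re * v.im - u.im * v.re

lemma wco_collinear {K : Set ℂ} (hc : Convex ℝ K) {P Q R : ℂ}
    (hP : P ∈ Set.extremePoints ℝ K) (hQ : Q ∈ Set.extremePoints ℝ K)
    (hR : R ∈ Set.extremePoints ℝ K) (hPQ : P ≠ Q) (hQR : Q ≠ R) (hPR : P ≠ R)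
    (h : wcoCross (Q - P) (R - Q) = 0) : False := by
  have key : ∀ {x y z : ℂ}, x ∈ Set.extremePoints ℝ K → y ∈ Set.extremePoints ℝ K →
      z ∈ Set.extremePoints ℝ K → Wbtw ℝ x y z → y = x ∨ y = z := by
    intro x y z hx hy hz hw
    have h2 : y ∈ ({x, z} : Set ℂ) := by
      refine wco_ext_mem hc ?_ hy ?_
      · rintro w (rfl | rfl)
        · exact hx.1
        · exact hz.1
      · rw [convexHull_pair]
        exact mem_segment_iff_wbtw.2 hw
    simpa using h2
  have hcol : Collinear ℝ ({P, Q, R} : Set ℂ) := by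
    rw [collinear_iff_of_mem (p₀ := P) (by simp)]
    refine ⟨Q - P, ?_⟩
    have hd : (Q - P) ≠ 0 := sub_ne_zero.2 hPQ.symm
    have hn : (Q - P).re ^ 2 + (Q - P).im ^ 2 ≠ 0 := by
      intro h0
      apply hd
      apply Complex.ext
      · simp only [Complex.zero_re]; nlinarith [sq_nonneg (Q - P).re, sq_nonneg (Q - P).im]
      · simp only [Complex.zero_im]; nlinarith [sq_nonneg (Q - P).re, sq_nonneg (Q - P).im]
    rintro p (rfl | rfl | rfl)
    · exact ⟨0, by simp⟩
    · exact ⟨1, by simp⟩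
    · obtain ⟨t, ht⟩ : ∃ t : ℝ, t = ((p - P).re * (Q - P).re + (p - P).im * (Q - P).im) /
        ((Q - P).re ^ 2 + (Q - P).im ^ 2) := ⟨_, rfl⟩
      refine ⟨t, ?_⟩
      simp only [wcoCross] at h
      apply Complex.ext
      · simp at h hn ht ⊢
        rw [ht]
        field_simp
        linear_combination (-(Q.im - P.im)) * h
      · simp at h hn ht ⊢
        rw [ht]
        field_simp
        linear_combination ((Q.re - P.re)) * h
  rcases hcol.wbtw_or_wbtw_or_wbtw with h1 | h1 | h1
  · rcases key hP hQ hR h1 with h | h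
    · exact hPQ h.symm
    · exact hQR h
  · rcases key hQ hR hP h1 with h | h
    · exact hQR h.symm
    · exact hPR h.symm
  · rcases key hR hP hQ h1 with h | h
    · exact hPR h
    · exact hPQ h

lemma wco_support {K : Set ℂ} (hc : Convex ℝ K) {O A B : ℂ} (hA : A ∈ K) (hB : B ∈ K)
    (hO : O ∈ interior K) (hs : segment ℝ A B ⊆ frontier K) (hAB : A ≠ B) :
    ((∀ X ∈ K, 0 ≤ wcoCross (B - A) (X - A)) ∧ 0 < wcoCross (B - A) (O - A)) ∨
    ((∀ X ∈ K, wcoCross (B - A) (X - A) ≤ 0) ∧ wcoCross (B - A) (O - A) < 0) := by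
  have hM : midpoint ℝ A B ∉ interior K := (hs (midpoint_mem_segment A B)).2
  obtain ⟨f, hf⟩ := geometric_hahn_banach_open_point hc.interior isOpen_interior hM
  have hf' : ∀ X ∈ K, f X ≤ f (midpoint ℝ A B) := by
    intro X hX
    have h1 : X ∈ closure (interior K) := by
      rw [hc.closure_interior_eq_closure_of_nonempty_interior ⟨O, hO⟩]
      exact subset_closure hX
    have h2 : closure (interior K) ⊆ {X | f X ≤ f (midpoint ℝ A B)} :=
      closure_minimal (fun x hx => (hf x hx).le) (isClosed_le f.continuous continuous_const)
    exact h2 h1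
  have hmid : f (midpoint ℝ A B) = (f A + f B) / 2 := by
    rw [midpoint_eq_smul_add, map_smul, map_add, smul_eq_mul, invOf_eq_inv]; ring
  have hfA := hf' A hA
  have hfB := hf' B hB
  have hfO := hf O hO
  rw [hmid] at hfA hfB hfO hf'
  have e1 : f A = f B := by linarith
  have hrep : ∀ v : ℂ, f v = v.re * f 1 + v.im * f Complex.I := by
    intro v
    conv_lhs => rw [show v = v.re • (1 : ℂ) + v.im • Complex.I by
      apply Complex.ext <;> simp]
    rw [map_add, map_smul, map_smul, smul_eq_mul, smul_eq_mul]
  set p := f 1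
  set q := f Complex.I
  have hd : (B - A) ≠ 0 := sub_ne_zero.2 hAB.symm
  have hn : 0 < (B - A).re ^ 2 + (B - A).im ^ 2 := by
    rcases lt_or_eq_of_le (add_nonneg (sq_nonneg (B - A).re) (sq_nonneg (B - A).im)) with h | h
    · exact h
    · exfalso
      apply hd
      apply Complex.ext
      · simp only [Complex.zero_re]; nlinarith [sq_nonneg (B - A).re, sq_nonneg (B - A).im]
      · simp only [Complex.zero_im]; nlinarith [sq_nonneg (B - A).re, sq_nonneg (B - A).im]
  have hker : (B - A).re * p + (B - A).im * q = 0 := by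
    rw [← hrep, map_sub]; linarith
  set c := q * (B - A).re - p * (B - A).im with hcdef
  have hcr : ∀ X, (f X - f A) * ((B - A).re ^ 2 + (B - A).im ^ 2)
      = c * wcoCross (B - A) (X - A) := by
    intro X
    rw [← map_sub, hrep (X - A), hcdef, wcoCross]
    linear_combination ((X - A).re * (B - A).re + (X - A).im * (B - A).im) * hker
  have hcO : c * wcoCross (B - A) (O - A) < 0 := by
    rw [← hcr]
    exact mul_neg_of_neg_of_pos (by linarith) hn
  have hcX : ∀ X ∈ K, c * wcoCross (B - A) (X - A) ≤ 0 := by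
    intro X hX
    rw [← hcr]
    exact mul_nonpos_of_nonpos_of_nonneg (by linarith [hf' X hX]) hn.le
  rcases lt_trichotomy c 0 with h | h | h
  · left
    refine ⟨fun X hX => ?_, ?_⟩
    · have := hcX X hX; by_contra hh; push Not at hh; nlinarith [mul_pos_of_neg_of_neg h hh]
    · by_contra hh; push Not at hh; nlinarith [mul_nonneg_of_nonpos_of_nonpos h.le hh]
  · rw [h] at hcO; simp at hcO
  · right
    refine ⟨fun X hX => ?_, ?_⟩
    · have := hcX X hX; by_contra hh; push Not at hh; nlinarith [mul_pos h hh]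
    · by_contra hh; push Not at hh; nlinarith [mul_nonneg h.le hh]

/-- core -/
lemma wco_core (a : ℕ → ℂ) (m : ℕ) (hm : 0 < m) (h0 : ∀ j, a j ≠ 0) (ham : a m = a 0)
    (him : ∀ j, 0 < Complex.arg (a (j + 1) / a j) ∧ Complex.arg (a (j + 1) / a j) < π)
    (hcone : ∀ j, 0 < j → j + 1 < m → ∀ α β : ℝ, 0 < α → 0 ≤ β →
      a 0 ≠ α * a j + β * a (j + 1)) :
    ∑ i ∈ Finset.range m, Complex.arg (a (i + 1) / a i) = 2 * π := by
  set Φ : ℕ → ℝ := fun n => ∑ i ∈ Finset.range n, Complex.arg (a (i + 1) / a i) with hΦ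
  have hsucc : ∀ n, Φ (n + 1) = Φ n + Complex.arg (a (n + 1) / a n) :=
    fun n => Finset.sum_range_succ _ _
  have hz : Φ 0 = 0 := by simp [hΦ]
  have hpol : ∀ n, a n = a 0 * ((‖a n‖ / ‖a 0‖ : ℝ) : ℂ) * Complex.exp (Φ n * Complex.I) := by
    intro n
    induction n with
    | zero =>
      have : ‖a 0‖ ≠ 0 := norm_ne_zero_iff.2 (h0 0)
      simp [hz, div_self this]
    | succ n ih =>
      have e := Complex.norm_mul_exp_arg_mul_I (a (n + 1) / a n)
      have e2 : a (n + 1) = a n * (a (n + 1) / a n) := by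
        rw [mul_div_cancel₀ _ (h0 n)]
      have hn : (‖a n‖ : ℂ) ≠ 0 := by exact_mod_cast norm_ne_zero_iff.2 (h0 n)
      have hn0 : (‖a 0‖ : ℂ) ≠ 0 := by exact_mod_cast norm_ne_zero_iff.2 (h0 0)
      calc a (n + 1) = a n * (a (n + 1) / a n) := e2
        _ = (a 0 * ((‖a n‖ / ‖a 0‖ : ℝ) : ℂ) * Complex.exp (Φ n * Complex.I)) *
            (‖a (n + 1) / a n‖ * Complex.exp (Complex.arg (a (n + 1) / a n) * Complex.I)) := by
          rw [e, ← ih]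
        _ = _ := by
          rw [hsucc, norm_div]
          push_cast
          rw [add_mul, Complex.exp_add]
          field_simp
  have hmono : StrictMono Φ := strictMono_nat_of_lt_succ fun n => by
    rw [hsucc]; linarith [(him n).1]
  obtain ⟨k, hk⟩ : ∃ k : ℤ, Φ m = k * (2 * π) := by
    have h1 := hpol m
    have hn0 : ‖a 0‖ ≠ 0 := norm_ne_zero_iff.2 (h0 0)
    rw [ham, div_self hn0] at h1
    have h2 : Complex.exp (Φ m * Complex.I) = 1 := by
      have : a 0 * Complex.exp (Φ m * Complex.I) = a 0 * 1 := by
        rw [mul_one]; simpa using h1.symm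
      exact mul_left_cancel₀ (h0 0) this
    obtain ⟨k, hk⟩ := Complex.exp_eq_one_iff.1 h2
    refine ⟨k, ?_⟩
    have h3 := congrArg Complex.im hk
    simpa using h3
  have hpi := Real.pi_pos
  have hpos : 0 < Φ m := by rw [← hz]; exact hmono hm
  have hk1 : 1 ≤ k := by
    by_contra hh
    have : (k : ℝ) ≤ 0 := by exact_mod_cast (by omega : k ≤ 0)
    nlinarith
  change Φ m = 2 * π
  rcases eq_or_lt_of_le hk1 with h | hk2
  · rw [hk, ← h]; simp
  exfalso
  have hk2' : (2 : ℝ) ≤ k := by exact_mod_cast hk2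
  have hbig : 4 * π ≤ Φ m := by rw [hk]; nlinarith
  have hex : ∃ n, 2 * π < Φ n := ⟨m, by linarith⟩
  classical
  obtain ⟨n, hn, hmin⟩ : ∃ n, 2 * π < Φ n ∧ ∀ j < n, ¬ 2 * π < Φ j :=
    ⟨Nat.find hex, Nat.find_spec hex, fun j hj => Nat.find_min hex hj⟩
  obtain _ | j := n
  · rw [hz] at hn; linarith
  have hj : Φ j ≤ 2 * π := not_lt.1 (hmin j (Nat.lt_succ_self j))
  have hs := hsucc j
  obtain ⟨ht0, ht1⟩ := him j
  have hjpos : 0 < j := by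
    rcases Nat.eq_zero_or_pos j with h | h
    · subst h; rw [hz] at hs; linarith
    · exact h
  have hjm : j + 1 < m := by
    rw [← hmono.lt_iff_lt]; linarith
  set θ := Complex.arg (a (j + 1) / a j)
  set δ := 2 * π - Φ j with hδ
  set ε := θ - δ with hε
  have hδ0 : 0 ≤ δ := by linarith
  have hε0 : 0 < ε := by linarith
  have hsε : 0 < Real.sin ε := Real.sin_pos_of_pos_of_lt_pi hε0 (by linarith)
  have hsδ : 0 ≤ Real.sin δ := Real.sin_nonneg_of_nonneg_of_le_pi hδ0 (by linarith)
  have hsθ : 0 < Real.sin θ := Real.sin_pos_of_pos_of_lt_pi ht0 ht1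
  have hN : ∀ i, 0 < ‖a i‖ := fun i => norm_pos_iff.2 (h0 i)
  refine hcone j hjpos hjm (Real.sin ε * ‖a 0‖ / (Real.sin θ * ‖a j‖))
    (Real.sin δ * ‖a 0‖ / (Real.sin θ * ‖a (j + 1)‖)) ?_ ?_ ?_
  · have := hN 0; have := hN j; positivity
  · have := hN 0; have := hN (j + 1); positivity
  have e1 : Complex.exp (Φ j * Complex.I) = Real.cos δ - Real.sin δ * Complex.I := by
    rw [Complex.exp_mul_I, ← Complex.ofReal_cos, ← Complex.ofReal_sin,
      show Φ j = 2 * π - δ by rw [hδ]; ring, Real.cos_two_pi_sub, Real.sin_two_pi_sub]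
    push_cast; ring
  have e2 : Complex.exp (Φ (j + 1) * Complex.I) = Real.cos ε + Real.sin ε * Complex.I := by
    rw [Complex.exp_mul_I, ← Complex.ofReal_cos, ← Complex.ofReal_sin,
      show Φ (j + 1) = ε + 2 * π by rw [hε, hδ, hs]; ring, Real.cos_add_two_pi,
      Real.sin_add_two_pi]
  have e3 : (Real.sin θ : ℂ) = Real.sin ε * Real.cos δ + Real.cos ε * Real.sin δ := by
    rw [show θ = ε + δ by rw [hε]; ring, Real.sin_add]; push_cast; ring
  have n0 : (‖a 0‖ : ℂ) ≠ 0 := by exact_mod_cast (hN 0).ne'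
  have n1 : (‖a j‖ : ℂ) ≠ 0 := by exact_mod_cast (hN j).ne'
  have n2 : (‖a (j + 1)‖ : ℂ) ≠ 0 := by exact_mod_cast (hN (j + 1)).ne'
  have n3 : (Real.sin θ : ℂ) ≠ 0 := by exact_mod_cast hsθ.ne'
  have p1 := hpol j
  have p2 := hpol (j + 1)
  rw [e1] at p1
  rw [e2] at p2
  have q1 : ((Real.sin ε * ‖a 0‖ / (Real.sin θ * ‖a j‖) : ℝ) : ℂ) * a j =
      a 0 * (Real.sin ε / Real.sin θ) * (Real.cos δ - Real.sin δ * Complex.I) := by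
    clear hN
    generalize ‖a j‖ = N at p1 n1 ⊢
    rw [p1]
    push_cast [-Complex.ofReal_sin, -Complex.ofReal_cos]
    field_simp
  have q2 : ((Real.sin δ * ‖a 0‖ / (Real.sin θ * ‖a (j + 1)‖) : ℝ) : ℂ) * a (j + 1) =
      a 0 * (Real.sin δ / Real.sin θ) * (Real.cos ε + Real.sin ε * Complex.I) := by
    clear hN
    generalize ‖a (j + 1)‖ = N at p2 n2 ⊢
    rw [p2]
    push_cast [-Complex.ofReal_sin, -Complex.ofReal_cos]
    field_simp
  rw [q1, q2]
  field_simp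
  rw [e3]
  ring

lemma wco_arg_im {z w : ℂ} (h : 0 < wcoCross z w) :
    0 < Complex.arg (w / z) ∧ Complex.arg (w / z) < π := by
  have hz : z ≠ 0 := by rintro rfl; simp [wcoCross] at h
  have him : 0 < (w / z).im := by
    have hn := Complex.normSq_pos.2 hz
    rw [Complex.div_im, ← sub_div]
    apply div_pos _ hn
    rw [wcoCross] at h; linarith
  refine ⟨?_, ?_⟩
  · refine lt_of_le_of_ne (Complex.arg_nonneg_iff.2 him.le) ?_
    intro h0
    have := (Complex.arg_eq_zero_iff.1 h0.symm).2
    linarith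
  · exact Complex.arg_lt_pi_iff.2 (Or.inr him.ne')

lemma wco_inside (A : ℕ → ℂ) (m : ℕ) (hm : 3 ≤ m) (hper : A m = A 0)
    (hinj : ∀ i j, A i = A j → i % m = j % m) (K : Set ℂ) (hc : Convex ℝ K)
    (hext : ∀ j, A j ∈ Set.extremePoints ℝ K)
    (hedge : ∀ j, segment ℝ (A j) (A (j + 1)) ⊆ frontier K) (O : ℂ) (hO : O ∈ interior K) :
    ∑ i ∈ Finset.range m, Complex.arg ((A (i + 1) - O) / (A i - O)) = 2 * π ∨
    ∑ i ∈ Finset.range m, Complex.arg ((A (i + 1) - O) / (A i - O)) = -(2 * π) := by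
  have hK : ∀ j, A j ∈ K := fun j => (hext j).1
  have hOK := interior_subset hO
  have hne : ∀ j d, 0 < d → d < m → A j ≠ A (j + d) := by
    intro j d hd hdm h
    have h1 : j ≡ j + d [MOD m] := hinj _ _ h
    have h2 : m ∣ d := by
      have := (Nat.modEq_iff_dvd' (Nat.le_add_right j d)).1 h1
      simpa using this
    exact absurd (Nat.le_of_dvd hd h2) (by omega)
  have hAO : ∀ j, A j ≠ O := by
    intro j h
    have := hedge j (left_mem_segment ℝ _ _)
    rw [h] at this
    exact this.2 hO
  have hsup := fun j => wco_support hc (hK j) (hK (j + 1)) hO (hedge j)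
    (hne j 1 one_pos (by omega))
  have hcr : ∀ P Q : ℂ, wcoCross (Q - P) (O - P) = wcoCross (P - O) (Q - O) := by
    intro P Q; simp [wcoCross]; ring
  -- cone condition, general
  have hcone : ∀ j, 0 < j → j + 1 < m → ∀ α β : ℝ, 0 < α → 0 ≤ β → α + β ≤ 1 →
      A 0 - O ≠ α * (A j - O) + β * (A (j + 1) - O) := by
    intro j hj hjm α β hα hβ hab h
    have hmem : A 0 ∈ ({O, A j, A (j + 1)} : Set ℂ) := by
      refine wco_ext_mem hc ?_ (hext 0) ?_
      · rintro w (rfl | rfl | rfl)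
        exacts [hOK, hK _, hK _]
      · have hcv := convex_convexHull ℝ ({O, A j, A (j + 1)} : Set ℂ)
        have i0 := subset_convexHull ℝ ({O, A j, A (j + 1)} : Set ℂ) (show O ∈ _ by simp)
        have i1 := subset_convexHull ℝ ({O, A j, A (j + 1)} : Set ℂ) (show A j ∈ _ by simp)
        have i2 := subset_convexHull ℝ ({O, A j, A (j + 1)} : Set ℂ) (show A (j + 1) ∈ _ by simp)
        have e : A 0 = ∑ i : Fin 3, (![1 - α - β, α, β] i) • (![O, A j, A (j + 1)] i) := by
          simp [Fin.sum_univ_three]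
          linear_combination h
        rw [e]
        refine hcv.sum_mem ?_ ?_ ?_
        · intro i _; fin_cases i <;> simp <;> linarith
        · simp [Fin.sum_univ_three]; ring
        · intro i _; fin_cases i
          exacts [i0, i1, i2]
    rcases hmem with h1 | h1 | h1
    · exact hAO 0 h1
    · exact hne 0 j hj (by omega) (by simpa using h1)
    · exact hne 0 (j + 1) (by omega) hjm (by simpa using h1)
  have hswap : ∀ j, (0 < wcoCross (A j - O) (A (j + 1) - O) ↔
      0 < wcoCross (A (j + 1) - O) (A (j + 1 + 1) - O)) := by
    intro j
    have hcol : wcoCross (A (j + 1) - A j) (A (j + 2) - A (j + 1)) ≠ 0 := fun h =>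
      wco_collinear hc (hext j) (hext (j + 1)) (hext (j + 2)) (hne j 1 one_pos (by omega))
        (hne (j + 1) 1 one_pos (by omega)) (hne j 2 two_pos (by omega)) h
    rw [← hcr, ← hcr]
    have r1 : wcoCross (A (j + 1) - A j) (A (j + 2) - A j) =
      wcoCross (A (j + 1) - A j) (A (j + 2) - A (j + 1)) := by simp [wcoCross]; ring
    have r2 : wcoCross (A (j + 1 + 1) - A (j + 1)) (A j - A (j + 1)) =
      wcoCross (A (j + 1) - A j) (A (j + 2) - A (j + 1)) := by simp [wcoCross]; ring
    rcases hsup j with ⟨h1, h2⟩ | ⟨h1, h2⟩ <;> rcases hsup (j + 1) with ⟨h3, h4⟩ | ⟨h3, h4⟩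
    · exact ⟨fun _ => h4, fun _ => h2⟩
    · exact absurd (le_antisymm (r2 ▸ h3 _ (hK j)) (r1 ▸ h1 _ (hK (j + 2)))) hcol
    · exact absurd (le_antisymm (r1 ▸ h1 _ (hK (j + 2))) (r2 ▸ h3 _ (hK j))) hcol
    · exact ⟨fun h => absurd h h2.not_gt, fun h => absurd h h4.not_gt⟩
  have hall : ∀ j, (0 < wcoCross (A 0 - O) (A 1 - O) ↔
      0 < wcoCross (A j - O) (A (j + 1) - O)) := by
    intro j
    induction j with
    | zero => rfl
    | succ n ih => exact ih.trans (hswap n)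
  have hid : ∀ (P Q R : ℂ) (α β : ℝ), R - O = α * (P - O) + β * (Q - O) →
      wcoCross (Q - P) (R - P) = (1 - α - β) * wcoCross (Q - P) (O - P) := by
    intro P Q R α β h
    have hre := congrArg Complex.re h
    have him := congrArg Complex.im h
    simp at hre him
    simp only [wcoCross, Complex.sub_re, Complex.sub_im]
    linear_combination (Q.re - P.re) * him - (Q.im - P.im) * hre
  by_cases hs : 0 < wcoCross (A 0 - O) (A 1 - O)
  · left
    have hp : ∀ j, 0 < wcoCross (A j - O) (A (j + 1) - O) := fun j => (hall j).1 hs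
    refine wco_core (fun j => A j - O) m (by omega) (fun j => sub_ne_zero.2 (hAO j))
      (by simp only [hper]) (fun j => wco_arg_im (hp j)) ?_
    intro j hj hjm α β hα hβ h
    refine hcone j hj hjm α β hα hβ ?_ h
    have h1 := hid _ _ _ _ _ h
    rcases hsup j with ⟨h3, h4⟩ | ⟨h3, h4⟩
    · have h5 := h3 _ (hK 0)
      rw [h1] at h5
      have := nonneg_of_mul_nonneg_left h5 h4
      linarith
    · rw [hcr] at h4; linarith [hp j]
  · right
    have hp : ∀ j, ¬ 0 < wcoCross (A j - O) (A (j + 1) - O) := fun j h => hs ((hall j).2 h)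
    have hsup' : ∀ j, (∀ X ∈ K, wcoCross (A (j + 1) - A j) (X - A j) ≤ 0) ∧
        wcoCross (A (j + 1) - A j) (O - A j) < 0 := by
      intro j
      rcases hsup j with ⟨h3, h4⟩ | h
      · rw [hcr] at h4; exact absurd h4 (hp j)
      · exact h
    have hcc : ∀ z w : ℂ, wcoCross (starRingEnd ℂ z) (starRingEnd ℂ w) = - wcoCross z w := by
      intro z w; simp [wcoCross]; ring
    have hp' : ∀ j, 0 < wcoCross (starRingEnd ℂ (A j - O)) (starRingEnd ℂ (A (j + 1) - O)) := by
      intro j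
      have := (hsup' j).2
      rw [hcr] at this
      rw [hcc]; linarith
    have hcore := wco_core (fun j => starRingEnd ℂ (A j - O)) m (by omega)
      (fun j => (map_ne_zero _).2 (sub_ne_zero.2 (hAO j)))
      (by simp only [hper]) (fun j => wco_arg_im (hp' j)) ?_
    · rw [← hcore, ← Finset.sum_neg_distrib]
      refine Finset.sum_congr rfl fun j _ => ?_
      have hlt := (wco_arg_im (hp' j)).2
      rw [← map_div₀] at hlt ⊢
      have h2 : Complex.arg ((A (j + 1) - O) / (A j - O)) ≠ π := by
        intro h
        rw [Complex.arg_conj, if_pos h] at hlt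
        exact lt_irrefl _ hlt
      rw [Complex.arg_conj, if_neg h2, neg_neg]
    intro j hj hjm α β hα hβ h
    have h' : A 0 - O = α * (A j - O) + β * (A (j + 1) - O) := by
      have := congrArg (starRingEnd ℂ) h
      simpa using this
    refine hcone j hj hjm α β hα hβ ?_ h'
    have h1 := hid _ _ _ _ _ h'
    obtain ⟨h3, h4⟩ := hsup' j
    have h5 := h3 _ (hK 0)
    rw [h1] at h5
    by_contra hh
    push Not at hh
    nlinarith [mul_pos_of_neg_of_neg (show 1 - α - β < 0 by linarith) h4]

lemma wco_outside (A : ℕ → ℂ) (m : ℕ) (hper : A m = A 0)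
    (K : Set ℂ) (hc : Convex ℝ K) (hcl : IsClosed K) (hK : ∀ j, A j ∈ K) (O : ℂ) (hO : O ∉ K) :
    ∑ i ∈ Finset.range m, Complex.arg ((A (i + 1) - O) / (A i - O)) = 0 := by
  obtain ⟨f, u, hu, hf⟩ := geometric_hahn_banach_point_closed hc hcl hO
  have hrep : ∀ v : ℂ, f v = v.re * f 1 + v.im * f Complex.I := by
    intro v
    conv_lhs => rw [show v = v.re • (1 : ℂ) + v.im • Complex.I by
      apply Complex.ext <;> simp]
    rw [map_add, map_smul, map_smul, smul_eq_mul, smul_eq_mul]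
  set w : ℂ := ⟨f 1, - f Complex.I⟩ with hw
  have hre : ∀ j, 0 < ((A j - O) * w).re := by
    intro j
    have h1 := hf _ (hK j)
    have h2 : f (A j - O) = ((A j - O) * w).re := by
      rw [hrep, Complex.mul_re]; simp [hw]
    rw [← h2, map_sub]; linarith
  have hne : ∀ j, (A j - O) * w ≠ 0 := by
    intro j h
    have := hre j
    rw [h] at this
    simp at this
  have harg : ∀ j, Complex.arg ((A (j + 1) - O) / (A j - O)) =
      Complex.arg ((A (j + 1) - O) * w) - Complex.arg ((A j - O) * w) := by
    intro j
    have hw0 : w ≠ 0 := right_ne_zero_of_mul (hne j)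
    rw [← mul_div_mul_right _ _ hw0]
    have b1 := Complex.abs_arg_lt_pi_div_two_iff.2 (Or.inl (hre (j + 1)))
    have b2 := Complex.abs_arg_lt_pi_div_two_iff.2 (Or.inl (hre j))
    rw [abs_lt] at b1 b2
    have := (Complex.arg_coe_angle_toReal_eq_arg ((A (j + 1) - O) * w / ((A j - O) * w)))
    rw [← this, Complex.arg_div_coe_angle (hne _) (hne _), ← Real.Angle.coe_sub,
      Real.Angle.toReal_coe_eq_self_iff]
    constructor <;> linarith
  simp_rw [harg]
  rw [Finset.sum_range_sub (fun j => Complex.arg ((A j - O) * w)), hper, sub_self]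

/-- winding number of the outline of a convex polygon: `0` around any
point outside the polygon, `±1` around any point of its interior. The outline
`A₁…A_m` (`m ≥ 3`) has pairwise distinct vertices, each being an extreme point of
the convex hull `K` of all of them, and the cyclic order agrees with the order
along the boundary of `K` (each edge lies in the frontier of `K`). -/
theorem winding_of_convex_outline (l : List ℂ) (hm : 3 ≤ l.length) (hnd : l.Nodup)
    (K : Set ℂ) (hK : K = convexHull ℝ {x : ℂ | x ∈ l})
    (hext : ∀ x ∈ l, x ∈ Set.extremePoints ℝ K)
    (hedge : ∀ i : Fin l.length, segment ℝ (l.get i) (cnext l i) ⊆ frontier K)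
    (O : ℂ) :
    (O ∉ K → windingSum O l = 0) ∧
    (O ∈ interior K → windingSum O l = 2 * π ∨ windingSum O l = -(2 * π)) := by
  have hpos : 0 < l.length := by omega
  set A : ℕ → ℂ := fun j => l.get ⟨j % l.length, Nat.mod_lt _ hpos⟩ with hA
  have hfin : ∀ i : Fin l.length, A i.1 = l.get i := by
    intro i
    simp [hA, Nat.mod_eq_of_lt i.2]
  have hfin' : ∀ i : Fin l.length, A (i.1 + 1) = cnext l i := fun i => rfl
  have hsum : windingSum O l =
      ∑ i ∈ Finset.range l.length, Complex.arg ((A (i + 1) - O) / (A i - O)) := by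
    rw [Finset.sum_range, windingSum]
    refine Finset.sum_congr rfl fun i _ => ?_
    rw [hfin, hfin']
  have hmem : ∀ j, A j ∈ l := fun j => List.get_mem _ _
  have hper : A l.length = A 0 := by simp [hA]
  have hc : Convex ℝ K := hK ▸ convex_convexHull ℝ _
  have hcl : IsClosed K := by
    rw [hK]
    exact (List.finite_toSet l).isClosed_convexHull ℝ
  have hinj : ∀ i j, A i = A j → i % l.length = j % l.length := by
    intro i j h
    have := hnd.injective_get h
    simpa using this
  have hedge' : ∀ j, segment ℝ (A j) (A (j + 1)) ⊆ frontier K := by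
    intro j
    have := hedge ⟨j % l.length, Nat.mod_lt _ hpos⟩
    rw [← hfin, ← hfin'] at this
    have e1 : A (j % l.length) = A j := by simp [hA]
    have e2 : A (j % l.length + 1) = A (j + 1) := by simp [hA]
    simpa only [e1, e2] using this
  rw [hsum]
  exact ⟨fun hO => wco_outside A _ hper K hc hcl (fun j => (hext _ (hmem j)).1) O hO,
    fun hO => wco_inside A _ hm hper hinj K hc (fun j => hext _ (hmem j)) hedge' O hO⟩
end

section
/- Let O be a point of ℝ². If two closed polygonal lines l₁ and l₂, neither passing through O, are homotopic in ℝ² ∖ {O}, then w(l₁, O) = w(l₂, O). In particular, if one closed polygonal line not passing through O is obtained from another by a single elementary cancellation in ℝ² ∖ {O}, then their winding numbers around O are equal. -/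
open Real

/-- Equality of lists up to cyclic rotation. -/
def CycEq {α : Type*} (l₁ l₂ : List α) : Prop := ∃ n : ℕ, l₂ = l₁.rotate n

/-- Elementary cancellation in `N`: removal of a vertex `B` whose cyclically adjacent
vertices `A`, `C` satisfy `convexHull {A, B, C} ⊆ N`. -/
def ElemCancel (N : Set ℂ) (l l' : List ℂ) : Prop :=
  ∃ (B : ℂ) (rest : List ℂ), rest ≠ [] ∧ CycEq l (B :: rest) ∧ CycEq l' rest ∧
    convexHull ℝ {rest.getLastD B, B, rest.headD B} ⊆ N

/-- Homotopy in `N`: the equivalence relation generated by cyclic rotation and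
elementary cancellations in `N`. -/
def Homotopic (N : Set ℂ) : List ℂ → List ℂ → Prop :=
  Relation.EqvGen (fun l l' => CycEq l l' ∨ ElemCancel N l l')


theorem arg_div_of_re_pos {z w : ℂ} (hz : 0 < z.re) (hw : 0 < w.re) :
    Complex.arg (z / w) = Complex.arg z - Complex.arg w := by
  have hz0 : z ≠ 0 := by rintro rfl; simp at hz
  have hw0 : w ≠ 0 := by rintro rfl; simp at hw
  have h1 := abs_lt.1 (Complex.abs_arg_lt_pi_div_two_iff.2 (Or.inl hz))
  have h2 := abs_lt.1 (Complex.abs_arg_lt_pi_div_two_iff.2 (Or.inl hw))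
  have h3 : Complex.arg w⁻¹ = - Complex.arg w := by
    rw [Complex.arg_inv, if_neg]
    intro h
    linarith [h2.2, Real.pi_pos]
  rw [div_eq_mul_inv, Complex.arg_mul hz0 (inv_ne_zero hw0), h3]
  · ring
  · rw [h3]
    constructor <;> linarith [h1.1, h1.2, h2.1, h2.2]

theorem arg_triangle (O A B C : ℂ) (h : convexHull ℝ {A, B, C} ⊆ ({O}ᶜ : Set ℂ)) :
    Complex.arg ((B - O) / (A - O)) + Complex.arg ((C - O) / (B - O)) =
      Complex.arg ((C - O) / (A - O)) := by
  have hO : O ∉ convexHull ℝ ({A, B, C} : Set ℂ) := fun hO => h hO rfl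
  have hfin : ({A, B, C} : Set ℂ).Finite := by simp
  obtain ⟨f, u, hu, hf⟩ := geometric_hahn_banach_point_closed
    (convex_convexHull ℝ ({A, B, C} : Set ℂ)) (hfin.isClosed_convexHull ℝ) hO
  have hlin : ∀ z : ℂ, f z = z.re * f 1 + z.im * f Complex.I := by
    intro z
    have : z = z.re • (1 : ℂ) + z.im • Complex.I := by
      apply Complex.ext <;> simp
    conv_lhs => rw [this]
    rw [map_add, map_smul, map_smul]
    rfl
  let w : ℂ := ⟨f 1, - f Complex.I⟩
  have hw : ∀ X ∈ ({A, B, C} : Set ℂ), 0 < (w * (X - O)).re := by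
    intro X hX
    have h1 := hf X (subset_convexHull ℝ _ hX)
    have h2 : (w * (X - O)).re = f X - f O := by
      rw [hlin X, hlin O]
      simp [w, Complex.mul_re]
      ring
    rw [h2]; linarith
  have hA := hw A (by simp)
  have hB := hw B (by simp)
  have hC := hw C (by simp)
  have hw0 : w ≠ 0 := by
    intro h0; rw [h0] at hA; simp at hA
  rw [← mul_div_mul_left (B - O) (A - O) hw0, ← mul_div_mul_left (C - O) (B - O) hw0,
    ← mul_div_mul_left (C - O) (A - O) hw0, arg_div_of_re_pos hB hA,
    arg_div_of_re_pos hC hB, arg_div_of_re_pos hC hA]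
  ring

theorem windingSum_eq (O : ℂ) (l : List ℂ) :
    windingSum O l =
      (List.zipWith (fun a b => Complex.arg ((b - O) / (a - O))) l (l.rotate 1)).sum := by
  rw [windingSum, ← List.sum_ofFn]
  congr 1
  apply List.ext_getElem
  · simp
  · intro i h1 h2
    simp [cnext, List.getElem_rotate]

theorem windingSum_cyc (O : ℂ) {l l' : List ℂ} (h : CycEq l l') :
    windingSum O l = windingSum O l' := by
  obtain ⟨n, rfl⟩ := h
  rw [windingSum_eq, windingSum_eq, List.rotate_rotate, add_comm n 1, ← List.rotate_rotate,
    ← List.zipWith_rotate_distrib _ _ _ _ (by simp)]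
  exact (List.rotate_perm _ n).sum_eq.symm

theorem zipWith_last (g : ℂ → ℂ → ℝ) (X Y D : ℂ) (t : List ℂ) : ∀ C : ℂ,
    (List.zipWith g (C :: t) (t ++ [X])).sum - g ((C :: t).getLastD D) X =
    (List.zipWith g (C :: t) (t ++ [Y])).sum - g ((C :: t).getLastD D) Y := by
  induction t with
  | nil => intro C; simp
  | cons a t ih =>
    intro C
    have := ih a
    simp only [List.cons_append, List.zipWith_cons_cons, List.sum_cons, List.getLastD_cons]
      at this ⊢
    linarith

theorem windingSum_cancel (O : ℂ) {l l' : List ℂ} (h : ElemCancel ({O}ᶜ : Set ℂ) l l') :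
    windingSum O l = windingSum O l' := by
  obtain ⟨B, rest, hne, h1, h2, h3⟩ := h
  rw [windingSum_cyc O h1, windingSum_cyc O h2]
  cases rest with
  | nil => exact absurd rfl hne
  | cons C t =>
    have ht := arg_triangle O _ _ _ h3
    have hz := zipWith_last (fun a b => Complex.arg ((b - O) / (a - O))) B C B t C
    rw [windingSum_eq, windingSum_eq]
    simp only [List.rotate_cons_succ, List.rotate_zero, List.cons_append,
      List.zipWith_cons_cons, List.sum_cons, List.headD_cons] at ht hz ⊢
    linarith

/-- the winding number around `O` is invariant under homotopy in
`ℝ² ∖ {O}`; in particular it is invariant under a single elementary cancellation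
in `ℝ² ∖ {O}`. -/
theorem windingNumber_homotopy_invariant (O : ℂ) :
    (∀ l₁ l₂ : List ℂ, l₁ ≠ [] → l₂ ≠ [] → NotThrough O l₁ → NotThrough O l₂ →
      Homotopic ({O}ᶜ : Set ℂ) l₁ l₂ → windingSum O l₁ = windingSum O l₂) ∧
    (∀ l₁ l₂ : List ℂ, l₁ ≠ [] → l₂ ≠ [] → NotThrough O l₁ → NotThrough O l₂ →
      ElemCancel ({O}ᶜ : Set ℂ) l₁ l₂ → windingSum O l₁ = windingSum O l₂) := by
  refine ⟨fun l₁ l₂ _ _ _ _ h => ?_, fun l₁ l₂ _ _ _ _ h => windingSum_cancel O h⟩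
  clear * - h
  induction h with
  | rel x y h => exact h.elim (windingSum_cyc O) (windingSum_cancel O)
  | refl x => rfl
  | symm x y _ ih => exact ih.symm
  | trans x y z _ _ ih1 ih2 => exact ih1.trans ih2
end

section
/- Let O be a point of ℝ² and let l be a closed polygonal line not passing through O. Then l is homotopic in ℝ² ∖ {O} to a one-point closed polygonal line if and only if w(l, O) = 0. -/
open Real

open Complex in
lemma mem_hull3 (O A B C : ℂ) : O ∈ convexHull ℝ {A, B, C} ↔
    ∃ a b c : ℝ, 0 ≤ a ∧ 0 ≤ b ∧ 0 ≤ c ∧ a + b + c = 1 ∧ (a:ℂ) * A + b * B + c * C = O := by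
  constructor
  · intro h
    rw [convexHull_insert (by simp), convexHull_pair, mem_convexJoin] at h
    obtain ⟨x, hx, y, ⟨b, c, hb, hc, hbc, rfl⟩, u, v, hu, hv, huv, rfl⟩ := h
    rw [Set.mem_singleton_iff] at hx
    subst hx
    refine ⟨u, v * b, v * c, hu, by positivity, by positivity, ?_, ?_⟩
    · rw [add_assoc, ← mul_add, hbc, mul_one, huv]
    · simp only [Complex.real_smul]; push_cast; ring
  · rintro ⟨a, b, c, ha, hb, hc, h1, rfl⟩
    have hA : A ∈ convexHull ℝ {A, B, C} := subset_convexHull ℝ _ (by simp)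
    have hB : B ∈ convexHull ℝ {A, B, C} := subset_convexHull ℝ _ (by simp)
    have hC : C ∈ convexHull ℝ {A, B, C} := subset_convexHull ℝ _ (by simp)
    have := (convex_convexHull ℝ ({A, B, C} : Set ℂ)).sum_mem (t := Finset.univ)
      (w := ![a, b, c]) (z := ![A, B, C])
      (by intro i _; fin_cases i <;> simpa) (by simp [Fin.sum_univ_three, h1])
      (by intro i _; fin_cases i <;> simpa)
    simpa [Fin.sum_univ_three] using this

def Tri (p q : ℂ) : Prop := ∃ a b c : ℝ, 0 ≤ a ∧ 0 ≤ b ∧ 0 ≤ c ∧ 0 < a + b + c ∧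
  (a:ℂ) * p + b + c * q = 0

lemma hull_iff_tri (O A B C : ℂ) (hB : B ≠ O) : O ∈ convexHull ℝ {A, B, C} ↔
    Tri ((A - O) / (B - O)) ((C - O) / (B - O)) := by
  have hB' : B - O ≠ 0 := sub_ne_zero.2 hB
  rw [mem_hull3]
  constructor
  · rintro ⟨a, b, c, ha, hb, hc, h1, h⟩
    refine ⟨a, b, c, ha, hb, hc, by linarith, ?_⟩
    have h1' : (a:ℂ) + b + c = 1 := by exact_mod_cast h1
    field_simp
    linear_combination h - O * h1'
  · rintro ⟨a, b, c, ha, hb, hc, h1, h⟩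
    have hs : ((a:ℂ) + b + c) ≠ 0 := by exact_mod_cast h1.ne'
    refine ⟨a / (a+b+c), b / (a+b+c), c / (a+b+c), by positivity, by positivity, by positivity,
      by field_simp, ?_⟩
    field_simp at h
    push_cast
    field_simp
    linear_combination h

lemma tri_symm {p q : ℂ} (h : Tri p q) : Tri q p := by
  obtain ⟨a, b, c, ha, hb, hc, h1, h⟩ := h
  exact ⟨c, b, a, hc, hb, ha, by linarith, by linear_combination h⟩

lemma not_tri_of_same {p q : ℂ} (hp : p ∈ Complex.slitPlane) (hq : q ∈ Complex.slitPlane)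
    (h : 0 ≤ p.im * q.im) : ¬ Tri p q := by
  rintro ⟨a, b, c, ha, hb, hc, h1, h2⟩
  have hre := congrArg Complex.re h2
  have him := congrArg Complex.im h2
  simp at hre him
  have e1 : (a * p.im) * (c * q.im) = 0 := by
    have : 0 ≤ (a * c) * (p.im * q.im) := by positivity
    have e : c * q.im = -(a * p.im) := by linarith
    have e' : (a * p.im) * (c * q.im) = -(a * p.im) ^ 2 := by rw [e]; ring
    nlinarith [sq_nonneg (a * p.im)]
  have e2 : a * p.im = 0 := by
    rcases mul_eq_zero.1 e1 with e | e <;> linarith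
  have e3 : c * q.im = 0 := by linarith
  rw [Complex.mem_slitPlane_iff] at hp hq
  have k1 : 0 ≤ a * p.re ∧ (a * p.re = 0 → a = 0) := by
    rcases mul_eq_zero.1 e2 with e | e
    · simp [e]
    · have : 0 < p.re := by tauto
      refine ⟨by positivity, fun h => ?_⟩
      rcases mul_eq_zero.1 h with h | h <;> linarith
  have k2 : 0 ≤ c * q.re ∧ (c * q.re = 0 → c = 0) := by
    rcases mul_eq_zero.1 e3 with e | e
    · simp [e]
    · have : 0 < q.re := by tauto
      refine ⟨by positivity, fun h => ?_⟩
      rcases mul_eq_zero.1 h with h | h <;> linarith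
  have := k1.2 (by linarith)
  have := k2.2 (by linarith)
  have : b = 0 := by linarith
  linarith

lemma slit_of_not_tri {p q : ℂ} (h : ¬ Tri p q) : p ∈ Complex.slitPlane := by
  by_contra hp
  rw [Complex.mem_slitPlane_iff] at hp
  push Not at hp
  refine h ⟨1, -p.re, 0, by simp, by linarith [hp.1], le_rfl, by linarith [hp.1], ?_⟩
  apply Complex.ext <;> simp [hp.2]

lemma arg_sub_lt {p q : ℂ} (h : ¬ Tri p q) : q.arg - p.arg < Real.pi := by
  by_contra hc
  push Not at hc
  have hp := slit_of_not_tri h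
  have hq := slit_of_not_tri (fun h' => h (tri_symm h'))
  have hp' := Complex.mem_slitPlane_iff_arg.1 hp
  have hq' := Complex.mem_slitPlane_iff_arg.1 hq
  have lp := Complex.neg_pi_lt_arg p
  have lq := lt_of_le_of_ne (Complex.arg_le_pi q) hq'.1
  have np : 0 < ‖p‖ := norm_pos_iff.2 hp'.2
  have nq : 0 < ‖q‖ := norm_pos_iff.2 hq'.2
  have iq : 0 < q.im := by
    rw [← Complex.norm_mul_sin_arg]
    exact mul_pos nq (Real.sin_pos_of_pos_of_lt_pi (by linarith) lq)
  have ip : p.im < 0 := Complex.arg_neg_iff.1 (by linarith)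
  have key : q.im * p.re - q.re * p.im ≤ 0 := by
    have e : q.im * p.re - q.re * p.im = ‖p‖ * ‖q‖ * Real.sin (q.arg - p.arg) := by
      rw [Real.sin_sub, ← Complex.norm_mul_sin_arg p, ← Complex.norm_mul_sin_arg q,
        ← Complex.norm_mul_cos_arg p, ← Complex.norm_mul_cos_arg q]
      ring
    rw [e]
    have : Real.sin (q.arg - p.arg) = - Real.sin (q.arg - p.arg - Real.pi) := by
      rw [Real.sin_sub_pi]; ring
    have h2 : 0 ≤ Real.sin (q.arg - p.arg - Real.pi) :=
      Real.sin_nonneg_of_nonneg_of_le_pi (by linarith) (by linarith)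
    have : Real.sin (q.arg - p.arg) ≤ 0 := by linarith
    exact mul_nonpos_of_nonneg_of_nonpos (by positivity) this
  refine h ⟨q.im, -(q.im * p.re - q.re * p.im), -p.im, iq.le, by linarith, by linarith,
    by linarith, ?_⟩
  apply Complex.ext <;> simp <;> ring

noncomputable def ang (O x y : ℂ) : ℝ := Complex.arg ((y - O) / (x - O))

lemma ang_add {O A B C : ℂ} (h : O ∉ convexHull ℝ {A, B, C}) :
    ang O A B + ang O B C = ang O A C := by
  have hA : A ≠ O := by rintro rfl; exact h (subset_convexHull ℝ _ (by simp))
  have hB : B ≠ O := by rintro rfl; exact h (subset_convexHull ℝ _ (by simp))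
  have hC : C ≠ O := by rintro rfl; exact h (subset_convexHull ℝ _ (by simp))
  rw [hull_iff_tri _ _ _ _ hB] at h
  have hA := sub_ne_zero.2 hA
  have hB := sub_ne_zero.2 hB
  have hC := sub_ne_zero.2 hC
  have l1 := arg_sub_lt h
  have l2 := arg_sub_lt (fun h' => h (tri_symm h'))
  have hp := Complex.mem_slitPlane_iff_arg.1 (slit_of_not_tri h)
  have e : ang O A B = - Complex.arg ((A - O) / (B - O)) := by
    rw [ang, ← inv_div, Complex.arg_inv, if_neg hp.1]
  have e2 : ang O A C = Complex.arg ((B - O) / (A - O) * ((C - O) / (B - O))) := by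
    rw [ang]; congr 1; field_simp
  rw [e2, (Complex.arg_mul_eq_add_arg_iff (div_ne_zero hB hA) (div_ne_zero hC hB)).2]
  · rfl
  · change ang O A B + _ ∈ _
    rw [e]
    constructor <;> linarith

lemma slit_of_seg {O A B : ℂ} (h : O ∉ segment ℝ A B) :
    A ≠ O ∧ B ≠ O ∧ (B - O) / (A - O) ∈ Complex.slitPlane := by
  have hA : A ≠ O := by rintro rfl; exact h (left_mem_segment ℝ _ _)
  have hB : B ≠ O := by rintro rfl; exact h (right_mem_segment ℝ _ _)
  refine ⟨hA, hB, ?_⟩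
  rw [← convexHull_pair, show ({A, B} : Set ℂ) = {B, A, B} by
    ext; simp, hull_iff_tri _ _ _ _ hA] at h
  exact slit_of_not_tri h

lemma hull_of_ang {O A B C : ℂ} (h1 : O ∉ segment ℝ A B) (h2 : O ∉ segment ℝ B C)
    (h : ang O A B * ang O B C ≤ 0) : O ∉ convexHull ℝ {A, B, C} := by
  rw [segment_symm] at h1
  obtain ⟨hB, hA, h1⟩ := slit_of_seg h1
  obtain ⟨-, hC, h2⟩ := slit_of_seg h2
  rw [hull_iff_tri _ _ _ _ hB]
  apply not_tri_of_same h1 h2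
  have hp := Complex.mem_slitPlane_iff_arg.1 h1
  have e : ang O A B = - Complex.arg ((A - O) / (B - O)) := by
    rw [ang, ← inv_div, Complex.arg_inv, if_neg hp.1]
  rw [e, ang] at h
  by_contra hc
  push Not at hc
  rcases mul_neg_iff.1 hc with ⟨a, b⟩ | ⟨a, b⟩
  · have := Complex.arg_neg_iff.2 b
    have h3 := Complex.arg_nonneg_iff.2 a.le
    have h4 : Complex.arg ((A - O) / (B - O)) ≠ 0 := by
      intro h; rw [Complex.arg_eq_zero_iff] at h; exact a.ne' h.2
    have := lt_of_le_of_ne h3 h4.symm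
    nlinarith
  · have := Complex.arg_neg_iff.2 a
    have h3 := Complex.arg_nonneg_iff.2 b.le
    have h4 : Complex.arg ((C - O) / (B - O)) ≠ 0 := by
      intro h; rw [Complex.arg_eq_zero_iff] at h; exact b.ne' h.2
    have := lt_of_le_of_ne h3 h4.symm
    nlinarith

def cyc {M : Type*} [AddCommMonoid M] (f : ℂ → ℂ → M) (l : List ℂ) : M :=
  (List.zipWith f l (l.rotate 1)).sum

lemma cyc_eq_sum {M : Type*} [AddCommMonoid M] (f : ℂ → ℂ → M) (l : List ℂ) :
    cyc f l = ∑ i : Fin l.length, f (l.get i) (cnext l i) := by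
  rw [← List.sum_ofFn, cyc]
  congr 1
  apply List.ext_getElem
  · simp
  · intro i h1 h2
    simp [cnext, List.getElem_rotate]

lemma cyc_rotate {M : Type*} [AddCommMonoid M] (f : ℂ → ℂ → M) (l : List ℂ) (n : ℕ) :
    cyc f (l.rotate n) = cyc f l := by
  unfold cyc
  rw [List.rotate_rotate, add_comm, ← List.rotate_rotate, ← List.zipWith_rotate_distrib _ _ _ _ (by simp)]
  exact (List.rotate_perm _ _).sum_eq

lemma cyc_cons {M : Type*} [AddCommMonoid M] (f : ℂ → ℂ → M) (B : ℂ) (rest : List ℂ)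
    (h : rest ≠ []) : ∃ R : M, cyc f (B :: rest) =
      R + (f (rest.getLastD B) B + f B (rest.headD B)) ∧
      cyc f rest = R + f (rest.getLastD B) (rest.headD B) := by
  obtain ⟨i, z, hz⟩ : ∃ i z, rest = i ++ [z] :=
    ⟨rest.dropLast, rest.getLast h, (List.dropLast_append_getLast h).symm⟩
  obtain ⟨y, t, hy⟩ := List.exists_cons_of_ne_nil h
  have hlen : i.length = t.length := by
    have := congrArg List.length (hz.symm.trans hy); simpa using this
  have hL : rest.getLastD B = z := by simp [hz]
  have hH : rest.headD B = y := by simp [hy]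
  rw [hL, hH]
  refine ⟨(List.zipWith f i t).sum, ?_, ?_⟩
  · have : cyc f (B :: rest) = f B y + (List.zipWith f rest (t ++ [B])).sum := by
      simp [cyc, hy]
    rw [this, hz, List.zipWith_append hlen]
    simp; abel
  · have : cyc f rest = (List.zipWith f rest (t ++ [y])).sum := by
      simp [cyc, hy]
    rw [this, hz, List.zipWith_append hlen]
    simp

open Classical in
noncomputable def bad (O x y : ℂ) : ℕ := if O ∈ segment ℝ x y then 1 else 0

lemma notThrough_iff (O : ℂ) (l : List ℂ) : NotThrough O l ↔ cyc (bad O) l = 0 := by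
  rw [cyc_eq_sum]
  simp [NotThrough, bad]

lemma wind_eq (O : ℂ) (l : List ℂ) : windingSum O l = cyc (ang O) l := by
  rw [cyc_eq_sum]; rfl

lemma cancel_inv {O : ℂ} {l l' : List ℂ} (h : ElemCancel {O}ᶜ l l') :
    cyc (ang O) l = cyc (ang O) l' ∧ (cyc (bad O) l = 0 → cyc (bad O) l' = 0) := by
  obtain ⟨B, rest, hr, ⟨n, hn⟩, ⟨m, hm⟩, hh⟩ := h
  have hO : O ∉ convexHull ℝ {rest.getLastD B, B, rest.headD B} := fun h => hh h rfl
  rw [← cyc_rotate _ l n, ← cyc_rotate _ l' m, ← cyc_rotate _ l n, ← cyc_rotate _ l' m, ← hn, ← hm]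
  constructor
  · obtain ⟨R, h1, h2⟩ := cyc_cons (ang O) B rest hr
    rw [h1, h2, ang_add hO]
  · obtain ⟨R, h1, h2⟩ := cyc_cons (bad O) B rest hr
    rw [h1, h2]
    intro h
    have : bad O (rest.getLastD B) (rest.headD B) = 0 := by
      rw [bad, if_neg]
      intro h
      exact hO (segment_subset_convexHull (by simp) (by simp) h)
    omega

lemma homotopic_inv {O : ℂ} {l l' : List ℂ} (h : Homotopic {O}ᶜ l l') :
    cyc (ang O) l = cyc (ang O) l' := by
  induction h with
  | rel x y h =>
    rcases h with ⟨n, rfl⟩ | h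
    · rw [cyc_rotate]
    · exact (cancel_inv h).1
  | refl => rfl
  | symm _ _ _ ih => exact ih.symm
  | trans _ _ _ _ _ ih1 ih2 => exact ih1.trans ih2

lemma exists_cancel {O : ℂ} {l : List ℂ} (h2 : 2 ≤ l.length) (hnt : NotThrough O l)
    (hw : cyc (ang O) l = 0) : ∃ l', l'.length + 1 = l.length ∧ ElemCancel {O}ᶜ l l' := by
  have hpos : 0 < l.length := by omega
  let v : ℕ → ℂ := fun k => l[k % l.length]'(Nat.mod_lt _ hpos)
  have hseg : ∀ k, O ∉ segment ℝ (v k) (v (k+1)) := by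
    intro k
    have := hnt ⟨k % l.length, Nat.mod_lt _ hpos⟩
    simpa [cnext, v] using this
  have hsum : ∑ k ∈ Finset.range l.length, ang O (v k) (v (k+1)) = 0 := by
    rw [Finset.sum_range, ← hw, cyc_eq_sum]
    refine Finset.sum_congr rfl fun i _ => ?_
    simp [v, cnext, Nat.mod_eq_of_lt i.isLt]
  obtain ⟨k, hk⟩ : ∃ k, ang O (v k) (v (k+1)) * ang O (v (k+1)) (v (k+1+1)) ≤ 0 := by
    by_contra hc
    push Not at hc
    set d : ℕ → ℝ := fun k => ang O (v k) (v (k+1)) with hd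
    have hc' : ∀ k, 0 < d k * d (k+1) := hc
    have hne : (Finset.range l.length).Nonempty := ⟨0, by simpa using hpos⟩
    rcases pos_and_pos_or_neg_and_neg_of_mul_pos (hc' 0) with h | h
    · have : ∀ k, 0 < d k := fun k => by
        induction k with
        | zero => exact h.1
        | succ k ih => exact (mul_pos_iff_of_pos_left ih).1 (hc' k)
      exact (Finset.sum_pos (fun k _ => this k) hne).ne' hsum
    · have : ∀ k, d k < 0 := fun k => by
        induction k with
        | zero => exact h.1
        | succ k ih => exact neg_of_mul_pos_right (hc' k) ih.le
      exact (Finset.sum_neg (fun k _ => this k) hne).ne hsum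
  have hlen : (l.rotate (k+1)).length = l.length := List.length_rotate ..
  obtain ⟨B, rest, hr⟩ := List.exists_cons_of_ne_nil
    (show l.rotate (k+1) ≠ [] by intro h; rw [h] at hlen; simp at hlen; omega)
  have hlr : rest.length + 1 = l.length := by rw [← hlen, hr]; simp
  have hrest : rest ≠ [] := by rintro rfl; simp at hlr; omega
  have hget : ∀ j (hj : j < (B :: rest).length), (B :: rest)[j] = v (j + (k + 1)) := by
    intro j hj
    simp only [← hr, List.getElem_rotate, v]
  have hB : B = v (k+1) := by
    have := hget 0 (by simp)
    rw [zero_add] at this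
    exact this
  have hH : rest.headD B = v (k+1+1) := by
    have := hget 1 (by simp; omega)
    rw [show k + 1 + 1 = 1 + (k+1) by ring, ← this]
    cases rest with
    | nil => exact absurd rfl hrest
    | cons a t => simp
  have hL : rest.getLastD B = v k := by
    have := hget rest.length (by simp)
    have e : v (rest.length + (k+1)) = v k := by
      have : (rest.length + (k+1)) % l.length = k % l.length := by
        rw [show rest.length + (k+1) = k + l.length by omega]; simp
      simp only [v, this]
    rw [← e, ← this, List.getLastD_eq_getLast?, List.getLast?_eq_getElem?]
    have : 0 < rest.length := List.length_pos_iff.2 hrest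
    simp [List.getElem_cons, this.ne', hrest, this]
  refine ⟨rest, hlr, B, rest, hrest, ⟨k+1, hr.symm⟩, ⟨0, by simp⟩, ?_⟩
  rw [hH, hL]
  intro x hx hxO
  rw [Set.mem_singleton_iff] at hxO
  subst hxO
  rw [hB] at hx
  exact hull_of_ang (hseg k) (hseg (k+1)) hk hx

lemma back (O : ℂ) (n : ℕ) : ∀ l : List ℂ, l.length = n + 1 → NotThrough O l →
    cyc (ang O) l = 0 → ∃ A : ℂ, A ≠ O ∧ Homotopic ({O}ᶜ : Set ℂ) l [A] := by
  induction n with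
  | zero =>
    intro l hl hnt _
    obtain ⟨A, rfl⟩ := List.length_eq_one_iff.1 (by simpa using hl)
    refine ⟨A, ?_, Relation.EqvGen.refl _⟩
    rintro rfl
    exact hnt ⟨0, by simp⟩ (left_mem_segment ℝ _ _)
  | succ n ih =>
    intro l hl hnt hw
    obtain ⟨l', hl', hc⟩ := exists_cancel (by omega) hnt hw
    obtain ⟨h1, h2⟩ := cancel_inv hc
    obtain ⟨A, hA, hh⟩ := ih l' (by omega)
      ((notThrough_iff _ _).2 (h2 ((notThrough_iff _ _).1 hnt))) (h1 ▸ hw)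
    exact ⟨A, hA, Relation.EqvGen.trans _ _ _ (Relation.EqvGen.rel _ _ (Or.inr hc)) hh⟩

/-- a closed polygonal line `l` not passing through `O` is homotopic
in `ℝ² ∖ {O}` to a one-point closed polygonal line iff `w(l, O) = 0`. -/
theorem homotopic_to_point_iff_winding_zero (O : ℂ) (l : List ℂ) (hl : l ≠ [])
    (hnt : NotThrough O l) :
    (∃ A : ℂ, A ≠ O ∧ Homotopic ({O}ᶜ : Set ℂ) l [A]) ↔ windingSum O l = 0 := by
  rw [wind_eq]
  constructor
  · rintro ⟨A, hA, h⟩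
    rw [homotopic_inv h]
    have : A - O ≠ 0 := sub_ne_zero.2 hA
    simp [cyc, ang, this]
  · intro hw
    have : 0 < l.length := List.length_pos_iff.2 hl
    exact back O (l.length - 1) l (by omega) hnt hw
end

section
/- Let l = A₁…A_m be a closed polygonal line not passing through a point O, let P ≠ O, and suppose the ray OP = {O + t(P − O) : t ≥ 0} contains no vertex of l. Then the number of indices i (mod m) such that the segment [Aᵢ, Aᵢ₊₁] intersects the ray OP has the same parity as w(l, O). -/
open Real

/-- The segment from `z` to `w` meets the closed negative real half-line. -/
def Crosses (z w : ℂ) : Prop :=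
  ∃ a b s : ℝ, 0 ≤ a ∧ 0 ≤ b ∧ a + b = 1 ∧ 0 ≤ s ∧
    a * z.re + b * w.re = -s ∧ a * z.im + b * w.im = 0

lemma arg_div_cases (z w : ℂ) (hz : z ≠ 0) (hw : w ≠ 0) :
    ∃ k : ℤ, Complex.arg (w / z) = Complex.arg w - Complex.arg z + 2 * π * k := by
  have h := Complex.arg_div_coe_angle hw hz
  rw [← Real.Angle.coe_sub, Real.Angle.angle_eq_iff_two_pi_dvd_sub] at h
  obtain ⟨k, hk⟩ := h
  exact ⟨k, by linarith⟩

lemma int_zero_of (x y : ℝ) (k : ℤ) (h : y = x + 2 * π * k) (h1 : -π < x) (h2 : x < π)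
    (h3 : -π < y) (h4 : y ≤ π) : k = 0 := by
  have hp := Real.pi_pos
  have a : (k : ℝ) < 1 := by nlinarith
  have b : (-1 : ℝ) < k := by nlinarith
  have a' : k < 1 := by exact_mod_cast a
  have b' : -1 < k := by exact_mod_cast b
  omega

lemma det_eq (z w : ℂ) : z.im * w.re - z.re * w.im
    = ‖z‖ * ‖w‖ * Real.sin (Complex.arg z - Complex.arg w) := by
  have h1 := Complex.norm_mul_cos_arg z
  have h2 := Complex.norm_mul_cos_arg w
  have h3 := Complex.norm_mul_sin_arg z
  have h4 := Complex.norm_mul_sin_arg w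
  rw [Real.sin_sub]
  linear_combination (-w.re) * h3 - (‖z‖ * Real.sin z.arg) * h2 + w.im * h1
    + (‖z‖ * Real.cos z.arg) * h4

lemma local_mixed (z w : ℂ) (hz : 0 < z.im) (hw : w.im < 0)
    (h0 : ¬ ∃ a b : ℝ, 0 ≤ a ∧ 0 ≤ b ∧ a + b = 1 ∧ 
      a * z.re + b * w.re = 0 ∧ a * z.im + b * w.im = 0) :
    (Crosses z w ∧ π < Complex.arg z - Complex.arg w) ∨
    (¬ Crosses z w ∧ Complex.arg z - Complex.arg w < π) := by
  have hd : 0 < z.im - w.im := by linarith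
  have hD := det_eq z w
  have hzn : 0 < ‖z‖ := norm_pos_iff.2 (by rintro rfl; simp at hz)
  have hwn : 0 < ‖w‖ := norm_pos_iff.2 (by rintro rfl; simp at hw)
  have hpos := mul_pos hzn hwn
  have az : 0 ≤ Complex.arg z := Complex.arg_nonneg_iff.2 hz.le
  have aw : Complex.arg w < 0 := Complex.arg_neg_iff.2 hw
  have az' := Complex.arg_le_pi z
  have aw' := Complex.neg_pi_lt_arg w
  rcases lt_trichotomy (z.im * w.re - z.re * w.im) 0 with h | h | h
  · left
    constructor
    · refine ⟨-w.im / (z.im - w.im), z.im / (z.im - w.im),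
        -(z.im * w.re - z.re * w.im) / (z.im - w.im), ?_, ?_, ?_, ?_, ?_, ?_⟩
      · apply div_nonneg <;> linarith
      · apply div_nonneg <;> linarith
      · field_simp; ring
      · apply div_nonneg <;> linarith
      · field_simp; ring
      · field_simp; ring
    · by_contra hc
      have := Real.sin_nonneg_of_nonneg_of_le_pi (x := Complex.arg z - Complex.arg w)
        (by linarith) (by linarith)
      nlinarith [mul_nonneg hpos.le this]
  · exfalso
    apply h0
    refine ⟨-w.im / (z.im - w.im), z.im / (z.im - w.im), ?_, ?_, ?_, ?_, ?_⟩
    · apply div_nonneg <;> linarith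
    · apply div_nonneg <;> linarith
    · field_simp; ring
    · field_simp; linarith
    · field_simp; ring
  · right
    constructor
    · rintro ⟨a, b, s, ha, hb, hab, hs, h1, h2⟩
      have hb' : b * (z.im - w.im) = z.im := by
        have : a = 1 - b := by linarith
        subst this; linarith
      have ha' : a * (z.im - w.im) = -w.im := by
        have : b = 1 - a := by linarith
        subst this; linarith
      have : z.im * w.re - z.re * w.im = -s * (z.im - w.im) := by
        rw [← h1]; linear_combination (-w.re) * hb' - z.re * ha'
      nlinarith [mul_nonneg hs hd.le]
    · by_contra hc
      have h5 : 0 ≤ Real.sin (Complex.arg z - Complex.arg w - π) :=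
        Real.sin_nonneg_of_nonneg_of_le_pi (by linarith) (by linarith)
      rw [Real.sin_sub_pi] at h5
      nlinarith [mul_nonneg hpos.le h5]

lemma crosses_symm {z w : ℂ} (h : Crosses z w) : Crosses w z := by
  obtain ⟨a, b, s, ha, hb, hab, hs, h1, h2⟩ := h
  exact ⟨b, a, s, hb, ha, by linarith, hs, by linarith, by linarith⟩

lemma not_crosses_same (z w : ℂ) (hz : 0 < z.re ∨ z.im ≠ 0) (hw : 0 < w.re ∨ w.im ≠ 0)
    (h : (0 ≤ z.im ∧ 0 ≤ w.im) ∨ (z.im ≤ 0 ∧ w.im ≤ 0)) : ¬ Crosses z w := by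
  rintro ⟨a, b, s, ha, hb, hab, hs, h1, h2⟩
  have e : a * z.im = 0 ∧ b * w.im = 0 := by
    rcases h with ⟨p, q⟩ | ⟨p, q⟩
    · have := mul_nonneg ha p
      have := mul_nonneg hb q
      constructor <;> linarith
    · have := mul_nonpos_of_nonneg_of_nonpos ha p
      have := mul_nonpos_of_nonneg_of_nonpos hb q
      constructor <;> linarith
  obtain ⟨e1, e2⟩ := e
  have p1 : a = 0 ∨ 0 < a * z.re := by
    rcases mul_eq_zero.1 e1 with e | e
    · exact Or.inl e
    · rcases ha.eq_or_lt with q | q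
      · exact Or.inl q.symm
      · exact Or.inr (mul_pos q (hz.resolve_right (by simp [e])))
  have p2 : b = 0 ∨ 0 < b * w.re := by
    rcases mul_eq_zero.1 e2 with e | e
    · exact Or.inl e
    · rcases hb.eq_or_lt with q | q
      · exact Or.inl q.symm
      · exact Or.inr (mul_pos q (hw.resolve_right (by simp [e])))
  rcases p1 with rfl | p1 <;> rcases p2 with rfl | p2 <;> simp at * <;> linarith

lemma local_parity (z w : ℂ) (hz : z ∈ Complex.slitPlane) (hw : w ∈ Complex.slitPlane)
    (h0 : ¬ ∃ a b : ℝ, 0 ≤ a ∧ 0 ≤ b ∧ a + b = 1 ∧ 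
      a * z.re + b * w.re = 0 ∧ a * z.im + b * w.im = 0) :
    ∃ k : ℤ, Complex.arg (w / z) = Complex.arg w - Complex.arg z + 2 * π * k ∧
      (Crosses z w → k % 2 = 1) ∧ (¬ Crosses z w → k % 2 = 0) := by
  obtain ⟨k, hk⟩ := arg_div_cases z w (Complex.slitPlane_ne_zero hz)
    (Complex.slitPlane_ne_zero hw)
  refine ⟨k, hk, ?_⟩
  have b1 := Complex.neg_pi_lt_arg (w / z)
  have b2 := Complex.arg_le_pi (w / z)
  have z1 := Complex.neg_pi_lt_arg z
  have w1 := Complex.neg_pi_lt_arg w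
  have z2 : Complex.arg z < π := lt_of_le_of_ne (Complex.arg_le_pi z)
    (Complex.mem_slitPlane_iff_arg.1 hz).1
  have w2 : Complex.arg w < π := lt_of_le_of_ne (Complex.arg_le_pi w)
    (Complex.mem_slitPlane_iff_arg.1 hw).1
  have hz' := Complex.mem_slitPlane_iff.1 hz
  have hw' := Complex.mem_slitPlane_iff.1 hw
  have fin0 : k = 0 → ¬ Crosses z w →
      ((Crosses z w → k % 2 = 1) ∧ (¬ Crosses z w → k % 2 = 0)) := by
    rintro rfl h; exact ⟨fun h' => absurd h' h, fun _ => rfl⟩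
  rcases le_or_gt 0 z.im with hzi | hzi <;> rcases le_or_gt 0 w.im with hwi | hwi
  · have := Complex.arg_nonneg_iff.2 hzi
    have := Complex.arg_nonneg_iff.2 hwi
    exact fin0 (int_zero_of _ _ k hk (by linarith) (by linarith) b1 b2)
      (not_crosses_same z w hz' hw' (Or.inl ⟨hzi, hwi⟩))
  · rcases hzi.eq_or_lt with e | hzi
    · have : Complex.arg z = 0 := Complex.arg_eq_zero_iff.2
        ⟨(hz'.resolve_right (by simp [← e])).le, e.symm⟩
      exact fin0 (int_zero_of _ _ k hk (by linarith) (by linarith) b1 b2)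
        (not_crosses_same z w hz' hw' (Or.inr ⟨e.symm.le, hwi.le⟩))
    · have := Complex.arg_nonneg_iff.2 hzi.le
      have := Complex.arg_neg_iff.2 hwi
      rcases local_mixed z w hzi hwi h0 with ⟨h, h'⟩ | ⟨h, h'⟩
      · have : k - 1 = 0 := int_zero_of (Complex.arg w - Complex.arg z + 2 * π) _ (k - 1)
          (by push_cast; linarith) (by linarith) (by linarith) b1 b2
        exact ⟨fun _ => by omega, fun q => absurd h q⟩
      · exact fin0 (int_zero_of _ _ k hk (by linarith) (by linarith) b1 b2) h
  · rcases hwi.eq_or_lt with e | hwi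
    · have : Complex.arg w = 0 := Complex.arg_eq_zero_iff.2
        ⟨(hw'.resolve_right (by simp [← e])).le, e.symm⟩
      exact fin0 (int_zero_of _ _ k hk (by linarith) (by linarith) b1 b2)
        (not_crosses_same z w hz' hw' (Or.inr ⟨hzi.le, e.symm.le⟩))
    · have := Complex.arg_nonneg_iff.2 hwi.le
      have := Complex.arg_neg_iff.2 hzi
      rcases local_mixed w z hwi hzi (by
        rintro ⟨a, b, ha, hb, hab, h1, h2⟩
        exact h0 ⟨b, a, hb, ha, by linarith, by linarith, by linarith⟩) with ⟨h, h'⟩ | ⟨h, h'⟩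
      · have : k + 1 = 0 := int_zero_of (Complex.arg w - Complex.arg z - 2 * π) _ (k + 1)
          (by push_cast; linarith) (by linarith) (by linarith) b1 b2
        exact ⟨fun _ => by omega, fun q => absurd (crosses_symm h) q⟩
      · exact fin0 (int_zero_of _ _ k hk (by linarith) (by linarith) b1 b2)
          (fun q => h (crosses_symm q))
  · have := Complex.arg_neg_iff.2 hzi
    have := Complex.arg_neg_iff.2 hwi
    exact fin0 (int_zero_of _ _ k hk (by linarith) (by linarith) b1 b2)
      (not_crosses_same z w hz' hw' (Or.inr ⟨hzi.le, hwi.le⟩))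

lemma sum_cnext (l : List ℂ) (f : ℂ → ℝ) :
    ∑ i : Fin l.length, f (cnext l i) = ∑ i : Fin l.length, f (l.get i) := by
  let σ : Fin l.length → Fin l.length := fun i =>
    ⟨(i.1 + 1) % l.length, Nat.mod_lt _ (Nat.lt_of_le_of_lt (Nat.zero_le _) i.isLt)⟩
  have hσ : Function.Injective σ := by
    intro i j h
    have h' : (i.1 + 1) % l.length = (j.1 + 1) % l.length := congrArg Fin.val h
    have hi := i.isLt
    have hj := j.isLt
    apply Fin.ext
    have := Nat.ModEq.add_right_cancel' 1 h'
    rwa [Nat.ModEq, Nat.mod_eq_of_lt hi, Nat.mod_eq_of_lt hj] at this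
  exact (Finite.injective_iff_bijective.1 hσ).sum_comp (fun i => f (l.get i))

lemma norm_comb (O P A B : ℂ) (hP : P ≠ O) (a b s : ℝ) (hab : a + b = 1) :
    (a • A + b • B = O + s • (P - O)) ↔
    (a * ((O - A) / (P - O)).re + b * ((O - B) / (P - O)).re = -s ∧
      a * ((O - A) / (P - O)).im + b * ((O - B) / (P - O)).im = 0) := by
  have hPO : P - O ≠ 0 := sub_ne_zero.2 hP
  have hab' : (a : ℂ) + b = 1 := by exact_mod_cast hab
  have : (a * ((O - A) / (P - O)).re + b * ((O - B) / (P - O)).re = -s ∧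
      a * ((O - A) / (P - O)).im + b * ((O - B) / (P - O)).im = 0) ↔
      (a : ℂ) * ((O - A) / (P - O)) + b * ((O - B) / (P - O)) = -(s : ℂ) := by
    rw [Complex.ext_iff]; simp
  rw [this, Complex.real_smul, Complex.real_smul, Complex.real_smul, ← mul_div_assoc,
    ← mul_div_assoc, ← add_div, div_eq_iff hPO]
  constructor
  · intro h; linear_combination O * hab' - h
  · intro h; linear_combination O * hab' - h

open scoped Classical in
/-- if the ray `OP` is in general position w.r.t. `l` (contains no
vertex of `l`), then the number of segments of `l` meeting the ray has the same
parity as `w(l, O)`. -/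
theorem parity_of_ray_crossings (O P : ℂ) (hP : P ≠ O) (l : List ℂ) (hl : l ≠ [])
    (ray : Set ℂ) (hray : ray = {z : ℂ | ∃ t : ℝ, 0 ≤ t ∧ z = O + t • (P - O)})
    (hnt : NotThrough O l) (hgen : ∀ v ∈ l, v ∉ ray) :
    ∃ n : ℤ, windingSum O l = 2 * π * n ∧
      (((Finset.univ : Finset (Fin l.length)).filter
        (fun i => (segment ℝ (l.get i) (cnext l i) ∩ ray).Nonempty)).card : ℤ) % 2
        = n % 2 := by
  classical
  have hPO : P - O ≠ 0 := sub_ne_zero.2 hP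
  subst hray
  let g : ℂ → ℂ := fun A => (O - A) / (P - O)
  have hmem : ∀ i, cnext l i ∈ l := fun i => List.get_mem _ _
  have hslit : ∀ v ∈ l, g v ∈ Complex.slitPlane := by
    intro v hv
    by_contra hc
    rw [Complex.mem_slitPlane_iff] at hc
    push Not at hc
    apply hgen v hv
    refine ⟨-(g v).re, by linarith [hc.1], ?_⟩
    have := (norm_comb O P v v hP 1 0 (-(g v).re) (by norm_num)).2
      ⟨by simp [g], by simpa [g] using hc.2⟩
    simpa using this
  have hcross : ∀ i : Fin l.length, (segment ℝ (l.get i) (cnext l i) ∩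
      {z : ℂ | ∃ t : ℝ, 0 ≤ t ∧ z = O + t • (P - O)}).Nonempty ↔
      Crosses (g (l.get i)) (g (cnext l i)) := by
    intro i
    constructor
    · rintro ⟨x, ⟨a, b, ha, hb, hab, rfl⟩, s, hs, h⟩
      exact ⟨a, b, s, ha, hb, hab, hs, (norm_comb O P _ _ hP a b s hab).1 h⟩
    · rintro ⟨a, b, s, ha, hb, hab, hs, h⟩
      exact ⟨_, ⟨a, b, ha, hb, hab, rfl⟩, s, hs, (norm_comb O P _ _ hP a b s hab).2 h⟩
  have hloc : ∀ i : Fin l.length, ∃ k : ℤ,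
      Complex.arg ((cnext l i - O) / (l.get i - O)) =
        Complex.arg (g (cnext l i)) - Complex.arg (g (l.get i)) + 2 * π * k ∧
      k % 2 = if (segment ℝ (l.get i) (cnext l i) ∩
        {z : ℂ | ∃ t : ℝ, 0 ≤ t ∧ z = O + t • (P - O)}).Nonempty then 1 else 0 := by
    intro i
    obtain ⟨k, hk, h1, h2⟩ := local_parity (g (l.get i)) (g (cnext l i))
      (hslit _ (List.get_mem _ _)) (hslit _ (hmem i)) (by
        rintro ⟨a, b, ha, hb, hab, h⟩
        apply hnt i
        refine ⟨a, b, ha, hb, hab, ?_⟩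
        have := (norm_comb O P (l.get i) (cnext l i) hP a b 0 hab).2 (by simpa [g] using h)
        simpa using this)
    refine ⟨k, ?_, ?_⟩
    · rw [← hk]
      congr 1
      simp only [g]
      rw [div_div_div_cancel_right₀ hPO, ← neg_sub O, ← neg_sub O, neg_div_neg_eq]
    · by_cases h : Crosses (g (l.get i)) (g (cnext l i))
      · rw [if_pos ((hcross i).2 h), h1 h]
      · rw [if_neg (fun q => h ((hcross i).1 q)), h2 h]
  choose k hk1 hk2 using hloc
  refine ⟨∑ i, k i, ?_, ?_⟩
  · unfold windingSum
    rw [Finset.sum_congr rfl (fun i _ => hk1 i), Finset.sum_add_distrib,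
      Finset.sum_sub_distrib, sum_cnext l (fun v => Complex.arg (g v)), ← Finset.mul_sum]
    push_cast
    ring
  · rw [Finset.card_filter, Finset.sum_int_mod _ _ k, Finset.sum_congr rfl (fun i _ => hk2 i)]
    push_cast
    rfl
end

section
/- Let R and B be disjoint finite sets of points on a circle in the plane, all points of R ∪ B pairwise distinct, with |R| and |B| even. For any two pairings of R, say M and M′, and any two pairings of B, say K and K′, the number of pairs (r, b) of a chord r determined by M and a chord b determined by K whose segments intersect has the same parity as the number of pairs of a chord determined by M′ and a chord determined by K′ whose segments intersect. In other words, the property of R and B being linked does not depend on the choice of the pairings. -/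
/-- `P` is a pairing of the finite set `S`: a partition of `S` into two-element
blocks, each block `{x, y}` recorded as a pair and determining the chord `[x, y]`. -/
def IsPairing (S : Finset ℂ) (P : Finset (ℂ × ℂ)) : Prop :=
  (∀ p ∈ P, p.1 ∈ S ∧ p.2 ∈ S ∧ p.1 ≠ p.2) ∧
  ∀ x ∈ S, ∃! p : ℂ × ℂ, p ∈ P ∧ (x = p.1 ∨ x = p.2)

open scoped Classical in
/-- The number of pairs of a chord of `M` and a chord of `K` whose segments meet. -/
noncomputable def linkCount (M K : Finset (ℂ × ℂ)) : ℕ :=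
  ((M ×ˢ K).filter
    (fun q => (segment ℝ q.1.1 q.1.2 ∩ segment ℝ q.2.1 q.2.2).Nonempty)).card

lemma pairing_sum {S : Finset ℂ} {P : Finset (ℂ × ℂ)} (h : IsPairing S P) (g : ℂ → ZMod 2) :
    ∑ p ∈ P, (g p.1 + g p.2) = ∑ x ∈ S, g x := by
  classical
  have hS : S = P.biUnion (fun p => {p.1, p.2}) := by
    ext x
    simp only [Finset.mem_biUnion, Finset.mem_insert, Finset.mem_singleton]
    constructor
    · intro hx
      obtain ⟨p, hp, -⟩ := h.2 x hx
      exact ⟨p, hp⟩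
    · rintro ⟨p, hp, rfl | rfl⟩
      · exact (h.1 p hp).1
      · exact (h.1 p hp).2.1
  have hd : (P : Set (ℂ × ℂ)).PairwiseDisjoint (fun p => ({p.1, p.2} : Finset ℂ)) := by
    intro p hp q hq hpq
    rw [Function.onFun, Finset.disjoint_left]
    intro x hx hx'
    simp only [Finset.mem_insert, Finset.mem_singleton] at hx hx'
    have hxS : x ∈ S := by
      rcases hx with rfl | rfl
      · exact (h.1 p hp).1
      · exact (h.1 p hp).2.1
    exact hpq ((h.2 x hxS).unique ⟨hp, hx⟩ ⟨hq, hx'⟩)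
  rw [hS, Finset.sum_biUnion hd]
  refine Finset.sum_congr rfl fun p hp => ?_
  rw [Finset.sum_pair (h.1 p hp).2.2]

/-- Orientation of the triple `a, b, p`. -/
noncomputable def orient (a b p : ℂ) : ℝ :=
  (b.re - a.re) * (p.im - a.im) - (b.im - a.im) * (p.re - a.re)

lemma sphere_eq {c : ℂ} {r : ℝ} {x : ℂ} (h : x ∈ Metric.sphere c r) :
    (x.re - c.re) ^ 2 + (x.im - c.im) ^ 2 = r ^ 2 := by
  rw [mem_sphere_iff_norm] at h
  rw [← h, ← Complex.normSq_eq_norm_sq, Complex.normSq_apply]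
  simp; ring

lemma orient_zero {a b z : ℂ} (hab : a ≠ b) (h : orient a b z = 0) :
    ∃ t : ℝ, z.re = a.re + t * (b.re - a.re) ∧ z.im = a.im + t * (b.im - a.im) := by
  unfold orient at h
  by_cases h1 : b.re - a.re = 0
  · have h2 : b.im - a.im ≠ 0 := by
      intro h2
      exact hab (Complex.ext (by linarith) (by linarith))
    refine ⟨(z.im - a.im) / (b.im - a.im), ?_, ?_⟩
    · rw [h1] at h ⊢
      have : (b.im - a.im) * (z.re - a.re) = 0 := by linarith
      have := (mul_eq_zero.1 this).resolve_left h2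
      linarith
    · field_simp; ring
  · refine ⟨(z.re - a.re) / (b.re - a.re), ?_, ?_⟩
    · field_simp; ring
    · field_simp; linarith

lemma chord_sq_pos {a b : ℂ} (hab : a ≠ b) : 0 < (b.re - a.re) ^ 2 + (b.im - a.im) ^ 2 := by
  by_contra hn
  have h1 : b.re - a.re = 0 := by nlinarith [sq_nonneg (b.re - a.re), sq_nonneg (b.im - a.im)]
  have h2 : b.im - a.im = 0 := by nlinarith [sq_nonneg (b.re - a.re), sq_nonneg (b.im - a.im)]
  exact hab (Complex.ext (by linarith) (by linarith))

lemma line_power {u v a1 a2 b1 b2 z1 z2 r t : ℝ}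
    (ha : (a1 - u) ^ 2 + (a2 - v) ^ 2 = r ^ 2) (hb : (b1 - u) ^ 2 + (b2 - v) ^ 2 = r ^ 2)
    (h1 : z1 = a1 + t * (b1 - a1)) (h2 : z2 = a2 + t * (b2 - a2)) :
    (z1 - u) ^ 2 + (z2 - v) ^ 2 = r ^ 2 - t * (1 - t) * ((b1 - a1) ^ 2 + (b2 - a2) ^ 2) := by
  subst h1 h2
  linear_combination (1 - t) * ha + t * hb

lemma orient_ne {c : ℂ} {r : ℝ} {a b p : ℂ} (ha : a ∈ Metric.sphere c r)
    (hb : b ∈ Metric.sphere c r) (hp : p ∈ Metric.sphere c r) (hab : a ≠ b) (hpa : p ≠ a)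
    (hpb : p ≠ b) : orient a b p ≠ 0 := by
  intro h
  obtain ⟨t, h1, h2⟩ := orient_zero hab h
  have := line_power (sphere_eq ha) (sphere_eq hb) h1 h2
  rw [sphere_eq hp] at this
  have h3 : t * (1 - t) * ((b.re - a.re) ^ 2 + (b.im - a.im) ^ 2) = 0 := by linarith
  rcases mul_eq_zero.1 ((mul_eq_zero.1 h3).resolve_right (chord_sq_pos hab).ne') with h4 | h4
  · subst h4
    exact hpa (Complex.ext (by linarith) (by linarith))
  · have : t = 1 := by linarith
    subst this
    exact hpb (Complex.ext (by linarith) (by linarith))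

lemma mem_seg {a b z : ℂ} : z ∈ segment ℝ a b ↔ ∃ t : ℝ, 0 ≤ t ∧ t ≤ 1 ∧
    z.re = a.re + t * (b.re - a.re) ∧ z.im = a.im + t * (b.im - a.im) := by
  rw [segment_eq_image']
  simp only [Set.mem_image, Set.mem_Icc]
  constructor
  · rintro ⟨t, ⟨h0, h1⟩, rfl⟩
    exact ⟨t, h0, h1, by simp, by simp⟩
  · rintro ⟨t, h0, h1, h2, h3⟩
    exact ⟨t, ⟨h0, h1⟩, Complex.ext (by simp [h2]) (by simp [h3])⟩

lemma inter_iff {c : ℂ} {r : ℝ} {a b p q : ℂ} (ha : a ∈ Metric.sphere c r)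
    (hb : b ∈ Metric.sphere c r) (hp : p ∈ Metric.sphere c r) (hq : q ∈ Metric.sphere c r)
    (hab : a ≠ b) (hpa : p ≠ a) (hpb : p ≠ b) (hqa : q ≠ a) (hqb : q ≠ b) (hpq : p ≠ q) :
    (segment ℝ a b ∩ segment ℝ p q).Nonempty ↔ ¬ (orient a b p < 0 ↔ orient a b q < 0) := by
  have np := orient_ne ha hb hp hab hpa hpb
  have nq := orient_ne ha hb hq hab hqa hqb
  constructor
  · rintro ⟨z, hz1, hz2⟩
    obtain ⟨t, -, -, h1, h2⟩ := mem_seg.1 hz1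
    obtain ⟨s, s0, s1, h3, h4⟩ := mem_seg.1 hz2
    have hz : (1 - s) * orient a b p + s * orient a b q = 0 := by
      have e : orient a b z = 0 := by unfold orient; rw [h1, h2]; ring
      rw [← e]; unfold orient; rw [h3, h4]; ring
    intro hiff
    rcases lt_or_gt_of_ne np with hp' | hp'
    · have hq' := hiff.1 hp'
      rcases s0.eq_or_lt with rfl | s0
      · simp at hz; exact np hz
      · nlinarith [mul_pos s0 (neg_pos.2 hq'), mul_nonneg (sub_nonneg.2 s1) (neg_pos.2 hp').le]
    · have hq' : 0 < orient a b q := by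
        rcases lt_or_gt_of_ne nq with h | h
        · exact absurd (hiff.2 h) (not_lt.2 hp'.le)
        · exact h
      rcases s0.eq_or_lt with rfl | s0
      · simp at hz; exact np hz
      · nlinarith [mul_pos s0 hq', mul_nonneg (sub_nonneg.2 s1) hp'.le]
  · intro hiff
    obtain ⟨s, s0, s1, hs⟩ : ∃ s : ℝ, 0 ≤ s ∧ s ≤ 1 ∧
        (1 - s) * orient a b p + s * orient a b q = 0 := by
      rcases lt_or_gt_of_ne np with hp' | hp'
      · have hq' : 0 < orient a b q := lt_of_le_of_ne (by
          by_contra h; exact hiff ⟨fun _ => not_le.1 h, fun _ => hp'⟩) nq.symm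
        have hd : 0 < orient a b q - orient a b p := by linarith
        refine ⟨-orient a b p / (orient a b q - orient a b p), by
          apply div_nonneg <;> linarith, by rw [div_le_one hd]; linarith, ?_⟩
        field_simp; ring
      · have hq' : orient a b q < 0 := by
          by_contra h; exact hiff ⟨fun h' => absurd hp' (not_lt.2 h'.le), fun h' => absurd h' h⟩
        have hd : 0 < orient a b p - orient a b q := by linarith
        refine ⟨orient a b p / (orient a b p - orient a b q), by
          apply div_nonneg <;> linarith, by rw [div_le_one hd]; linarith, ?_⟩
        field_simp; ring
    set z : ℂ := ⟨p.re + s * (q.re - p.re), p.im + s * (q.im - p.im)⟩ with hz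
    have e : orient a b z = 0 := by
      rw [← hs, hz]; unfold orient; ring
    obtain ⟨t, h1, h2⟩ := orient_zero hab e
    refine ⟨z, mem_seg.2 ⟨t, ?_⟩, mem_seg.2 ⟨s, s0, s1, rfl, rfl⟩⟩
    have e1 := line_power (sphere_eq ha) (sphere_eq hb) h1 h2
    have e2 := line_power (t := s) (z1 := z.re) (z2 := z.im) (sphere_eq hp) (sphere_eq hq) rfl rfl
    have hs' : 0 ≤ s * (1 - s) * ((q.re - p.re) ^ 2 + (q.im - p.im) ^ 2) :=
      mul_nonneg (mul_nonneg s0 (by linarith)) (by positivity)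
    have ht : 0 ≤ t * (1 - t) * ((b.re - a.re) ^ 2 + (b.im - a.im) ^ 2) := by linarith
    have ht' : 0 ≤ t * (1 - t) := nonneg_of_mul_nonneg_left ht (chord_sq_pos hab)
    exact ⟨by nlinarith, by nlinarith, h1, h2⟩

open scoped Classical in
lemma linkCount_cast (M K : Finset (ℂ × ℂ)) : (linkCount M K : ZMod 2) =
    ∑ m ∈ M, ∑ k ∈ K,
      if (segment ℝ m.1 m.2 ∩ segment ℝ k.1 k.2).Nonempty then 1 else 0 := by
  unfold linkCount
  rw [Finset.card_filter, Nat.cast_sum, Finset.sum_product]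
  simp

lemma linkCount_comm (M K : Finset (ℂ × ℂ)) : (linkCount M K : ZMod 2) = linkCount K M := by
  rw [linkCount_cast, linkCount_cast, Finset.sum_comm]
  refine Finset.sum_congr rfl fun k _ => Finset.sum_congr rfl fun m _ => ?_
  rw [Set.inter_comm]

lemma linkCount_right {c : ℂ} {r : ℝ} {R B : Finset ℂ} (hdisj : Disjoint R B)
    (hcirc : ∀ x ∈ R ∪ B, x ∈ Metric.sphere c r) {M K K' : Finset (ℂ × ℂ)}
    (hM : IsPairing R M) (hK : IsPairing B K) (hK' : IsPairing B K') :
    (linkCount M K : ZMod 2) = linkCount M K' := by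
  classical
  have key : ∀ L, IsPairing B L → (linkCount M L : ZMod 2) =
      ∑ m ∈ M, ∑ x ∈ B, if orient m.1 m.2 x < 0 then 1 else 0 := by
    intro L hL
    rw [linkCount_cast]
    refine Finset.sum_congr rfl fun m hm => ?_
    rw [← pairing_sum hL]
    refine Finset.sum_congr rfl fun k hk => ?_
    obtain ⟨m1, m2, m3⟩ := hM.1 m hm
    obtain ⟨k1, k2, k3⟩ := hL.1 k hk
    have hR : ∀ x ∈ R, x ∈ Metric.sphere c r := fun x hx => hcirc x (Finset.mem_union_left _ hx)
    have hB : ∀ x ∈ B, x ∈ Metric.sphere c r := fun x hx => hcirc x (Finset.mem_union_right _ hx)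
    have hne : ∀ x ∈ B, ∀ y ∈ R, x ≠ y := by
      rintro x hx y hy rfl
      exact Finset.disjoint_left.1 hdisj hy hx
    have := inter_iff (hR _ m1) (hR _ m2) (hB _ k1) (hB _ k2) m3 (hne _ k1 _ m1) (hne _ k1 _ m2)
      (hne _ k2 _ m1) (hne _ k2 _ m2) k3
    by_cases h1 : orient m.1 m.2 k.1 < 0 <;> by_cases h2 : orient m.1 m.2 k.2 < 0 <;>
      simp only [this, h1, h2] <;> decide
  rw [key K hK, key K' hK']

/-- for disjoint finite sets `R` (red) and `B` (blue) of points on a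
circle, with `|R|` and `|B|` even, the parity of the number of intersecting
red-blue chord pairs does not depend on the choice of the pairings of `R` and of
`B`; i.e. the property of being linked is well-defined. -/
theorem linked_independent_of_pairings (c : ℂ) (r : ℝ) (hr : 0 < r)
    (R B : Finset ℂ) (hdisj : Disjoint R B)
    (hcirc : ∀ x ∈ R ∪ B, x ∈ Metric.sphere c r)
    (hReven : Even R.card) (hBeven : Even B.card)
    (M M' K K' : Finset (ℂ × ℂ))
    (hM : IsPairing R M) (hM' : IsPairing R M')
    (hK : IsPairing B K) (hK' : IsPairing B K') :
    linkCount M K % 2 = linkCount M' K' % 2 := by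
  have h1 := linkCount_right hdisj hcirc hM hK hK'
  have h2 := linkCount_right hdisj.symm (by rwa [Finset.union_comm]) hK' hM hM'
  rw [← linkCount_comm M, ← linkCount_comm M'] at h2
  exact (ZMod.natCast_eq_natCast_iff' _ _ _).1 (h1.trans h2)
end
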